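/- arXiv:1712.00831 — 2 statements merged into one kernel-verified Lean document; each statement's English description precedes it below -/
import Mathlib

section
/- Let 2 ≤ s < t be integers of the same parity, let G be an n-vertex graph, and let U_1,…,U_s ⊆ V(G) be pairwise disjoint vertex sets such that there is no path of length t−1 inside U_1 ∪ ⋯ ∪ U_s between a vertex of U_1 and a vertex of U_s. Then the number of paths u_1,…,u_s with u_i ∈ U_i satisfies: p(U_1,…,U_s) ≤ ((t−s)/2)^{(s−1)/2} n^{(s−3)/2} (|U_1||U_s| + ((t−s)/2)n) if s is odd, and p(U_1,…,U_s) ≤ ((t−s)/2)^{s/2} n^{s/2−1} (|U_1|+|U_2|) if s is even. -/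
open SimpleGraph

/-- Number of unlabeled copies of `H` in `G`, i.e. the number of subgraphs of `G`
whose coercion is isomorphic to `H`. -/
noncomputable def copyCount {α β : Type*} (H : SimpleGraph α) (G : SimpleGraph β) : ℕ :=
  Nat.card {G' : G.Subgraph // Nonempty (H ≃g G'.coe)}

/-- `G` contains no cycle of length `m`. -/
def CycleFree {V : Type*} (G : SimpleGraph V) (m : ℕ) : Prop :=
  ∀ ⦃v : V⦄ (w : G.Walk v v), w.IsCycle → w.length ≠ m

/-- The number of `(U 0, …, U (k-1))`-cycles in `G`. -/
noncomputable def cCount {V : Type*} (G : SimpleGraph V) {k : ℕ} (U : Fin k → Set V) : ℕ :=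
  Nat.card {u : Fin k → V // (∀ i, u i ∈ U i) ∧ ∀ i : Fin k, G.Adj (u i) (u ⟨(i.val + 1) % k, Nat.mod_lt _ i.pos⟩)}

/-- The number of `(U 0, …, U (k-1))`-paths in `G`. -/
noncomputable def pCount {V : Type*} (G : SimpleGraph V) {k : ℕ} (U : Fin k → Set V) : ℕ :=
  Nat.card {u : Fin k → V // (∀ i, u i ∈ U i) ∧
    ∀ (i : ℕ) (h : i + 1 < k), G.Adj (u ⟨i, Nat.lt_of_succ_lt h⟩) (u ⟨i + 1, h⟩)}

/-- The number of edges of `G` between the disjoint sets `X` and `Y`. -/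
noncomputable def eCount {V : Type*} (G : SimpleGraph V) (X Y : Set V) : ℕ :=
  Nat.card {p : V × V // p.1 ∈ X ∧ p.2 ∈ Y ∧ G.Adj p.1 p.2}

/-- The neighbourhood of `v` inside the set `Y`. -/
def nbhdIn {V : Type*} (G : SimpleGraph V) (v : V) (Y : Set V) : Set V :=
  {y ∈ Y | G.Adj v y}

/-- The independence number of a finite graph. -/
noncomputable def indepNum {W : Type*} [Fintype W] (G : SimpleGraph W) : ℕ :=
  sSup {m | ∃ s : Finset W, (∀ a ∈ s, ∀ b ∈ s, ¬ G.Adj a b) ∧ s.card = m}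

open Finset in
/-- If every pair of nonempty subsets of `X` and `Y` contains a vertex with at most `c` neighbours
in the opposite subset, then the edges between `X` and `Y`, weighted at their ends in `Y`, have
small total weight. -/
theorem sum_weight_le_of_no_dense_pair {V : Type*} [DecidableEq V] (G : SimpleGraph V)
    [DecidableRel G.Adj] (c M : ℕ) (b : V → ℕ) (X Y : Finset V)
    (hcore : ∀ X' ⊆ X, ∀ Y' ⊆ Y, X'.Nonempty → Y'.Nonempty →
      (∀ x ∈ X', c < #{y ∈ Y' | G.Adj x y}) → ¬ ∀ y ∈ Y', c < #{x ∈ X' | G.Adj y x})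
    (hM : ∀ y ∈ Y, b y ≤ M) :
    ∑ x ∈ X, ∑ y ∈ Y with G.Adj x y, b y ≤ c * (#X * M) + c * ∑ y ∈ Y, b y := by
  induction hN : #X + #Y using Nat.strong_induction_on generalizing X Y with
  | _ N ih =>
  rcases X.eq_empty_or_nonempty with rfl | hX
  · simp
  rcases Y.eq_empty_or_nonempty with rfl | hY
  · simp
  by_cases h : ∀ x ∈ X, c < #{y ∈ Y | G.Adj x y}
  · have h2 := hcore X subset_rfl Y subset_rfl hX hY h
    push Not at h2
    obtain ⟨y, hy, hyc⟩ := h2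
    have h3 := ih (#X + #(Y.erase y)) (by have := card_erase_lt_of_mem hy; omega) X (Y.erase y)
      (fun X' hX' Y' hY' => hcore X' hX' Y' (hY'.trans (erase_subset _ _)))
      (fun z hz => hM z (mem_of_mem_erase hz)) rfl
    have h4 : ∑ x ∈ X, ∑ z ∈ Y with G.Adj x z, b z
        = ∑ x ∈ X, ∑ z ∈ Y.erase y with G.Adj x z, b z + #{x ∈ X | G.Adj y x} * b y := by
      rw [card_filter, sum_mul, ← sum_add_distrib]
      refine sum_congr rfl fun x _ => ?_
      rw [sum_filter, sum_filter, ← sum_erase_add _ _ hy]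
      simp [G.adj_comm x y]
    rw [h4, ← sum_erase_add _ _ hy]
    have := Nat.mul_le_mul_right (b y) hyc
    linarith
  · push Not at h
    obtain ⟨x, hx, hxc⟩ := h
    have h3 := ih (#(X.erase x) + #Y) (by have := card_erase_lt_of_mem hx; omega) (X.erase x) Y
      (fun X' hX' Y' hY' => hcore X' (hX'.trans (erase_subset _ _)) Y' hY') hM rfl
    rw [← sum_erase_add _ _ hx, ← card_erase_add_one hx]
    have h4 : ∑ y ∈ Y with G.Adj x y, b y ≤ #{y ∈ Y | G.Adj x y} * M := by
      rw [← smul_eq_mul]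
      exact sum_le_card_nsmul _ _ _ fun y hy => hM y (mem_filter.1 hy).1
    have := Nat.mul_le_mul_right M hxc
    linarith

open Finset in
/-- In a pair of sets with large minimum degree, a path ending in `Y` can be prolonged by a
path alternating between `X` and `Y`. -/
theorem exists_zigzag_path {V : Type*} [DecidableEq V] (G : SimpleGraph V)
    [DecidableRel G.Adj] (c : ℕ) (X Y : Finset V) (hXY : Disjoint X Y)
    (hX : ∀ x ∈ X, c < #{y ∈ Y | G.Adj x y}) (hY : ∀ y ∈ Y, c < #{x ∈ X | G.Adj y x})
    {y b : V} (hy : y ∈ Y) (q : G.Walk y b) (hq : q.IsPath)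
    (hqs : ∀ w ∈ q.support, w = y ∨ w ∉ X ∧ w ∉ Y) (k : ℕ) (hk : k ≤ c) :
    ∃ x ∈ X, ∃ p : G.Walk x b, p.IsPath ∧ p.length = q.length + 2 * k + 1 ∧
      (∀ w ∈ p.support, w ∈ X ∨ w ∈ Y ∨ w ∈ q.support) ∧
      #{w ∈ X | w ∈ p.support} ≤ k + 1 ∧ #{w ∈ Y | w ∈ p.support} ≤ k + 1 := by
  have hXY' : ∀ x ∈ X, x ∉ Y := fun x hx hx' => (Finset.disjoint_left.1 hXY) hx hx'
  induction k with
  | zero =>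
    obtain ⟨x, hx⟩ := card_pos.1 ((Nat.zero_le c).trans_lt (hY y hy))
    obtain ⟨hxX, hyx⟩ := mem_filter.1 hx
    refine ⟨x, hxX, .cons hyx.symm q, ?_, by simp, ?_, ?_, ?_⟩
    · rw [Walk.cons_isPath_iff]
      refine ⟨hq, fun hmem => ?_⟩
      rcases hqs x hmem with rfl | h
      · exact hXY' _ hxX hy
      · exact h.1 hxX
    · intro w hw
      rw [Walk.support_cons, List.mem_cons] at hw
      rcases hw with rfl | hw
      · exact Or.inl hxX
      · exact Or.inr (Or.inr hw)
    · refine (card_le_card (t := {x}) fun w hw => ?_).trans (by simp)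
      simp only [Walk.support_cons, List.mem_cons, mem_filter, mem_singleton] at hw ⊢
      grind
    · refine (card_le_card (t := {y}) fun w hw => ?_).trans (by simp)
      simp only [Walk.support_cons, List.mem_cons, mem_filter, mem_singleton] at hw ⊢
      grind
  | succ k ih =>
    obtain ⟨x, hx, p, hp, hpl, hps, hpX, hpY⟩ := ih (by omega)
    obtain ⟨y', hy', hy'p⟩ := exists_mem_notMem_of_card_lt_card
      (s := {w ∈ Y | w ∈ p.support}) (t := {y ∈ Y | G.Adj x y}) (by have := hX x hx; omega)
    obtain ⟨hy'Y, hxy'⟩ := mem_filter.1 hy'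
    have hy'p' : y' ∉ p.support := fun h => hy'p (mem_filter.2 ⟨hy'Y, h⟩)
    obtain ⟨x', hx', hx'p⟩ := exists_mem_notMem_of_card_lt_card
      (s := {w ∈ X | w ∈ p.support}) (t := {x ∈ X | G.Adj y' x}) (by have := hY y' hy'Y; omega)
    obtain ⟨hx'X, hyx'⟩ := mem_filter.1 hx'
    have hx'p' : x' ∉ p.support := fun h => hx'p (mem_filter.2 ⟨hx'X, h⟩)
    refine ⟨x', hx'X, .cons hyx'.symm (.cons hxy'.symm p), ?_, ?_, ?_, ?_, ?_⟩
    · rw [Walk.cons_isPath_iff, Walk.cons_isPath_iff, Walk.support_cons, List.mem_cons]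
      refine ⟨⟨hp, hy'p'⟩, ?_⟩
      rintro (rfl | h)
      · exact hXY' _ hx'X hy'Y
      · exact hx'p' h
    · simp [hpl]; ring
    · intro w hw
      simp only [Walk.support_cons, List.mem_cons] at hw
      rcases hw with rfl | rfl | hw
      · exact Or.inl hx'X
      · exact Or.inr (Or.inl hy'Y)
      · exact hps w hw
    · refine le_trans (card_le_card (t := insert x' {w ∈ X | w ∈ p.support}) ?_)
        ((card_insert_le _ _).trans (by omega))
      intro w hw
      simp only [Walk.support_cons, List.mem_cons, mem_filter, mem_insert] at hw ⊢
      grind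
    · refine le_trans (card_le_card (t := insert y' {w ∈ Y | w ∈ p.support}) ?_)
        ((card_insert_le _ _).trans (by omega))
      intro w hw
      simp only [Walk.support_cons, List.mem_cons, mem_filter, mem_insert] at hw ⊢
      grind

/-- The sequence `u` runs through a `(U 0, …, U r)`-path of `G`. -/
def IsTransversalPath {V : Type*} (G : SimpleGraph V) (U : ℕ → Set V) (r : ℕ) (u : ℕ → V) : Prop :=
  (∀ i ≤ r, u i ∈ U i) ∧ ∀ i < r, G.Adj (u i) (u (i + 1))

/-- Prolonging a path backwards along a transversal path by one vertex. -/
theorem IsTransversalPath.exists_cons {V : Type*} {G : SimpleGraph V} {U : ℕ → Set V} {r : ℕ}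
    {u : ℕ → V} (hu : IsTransversalPath G U r u) (hU : ∀ i j, i ≠ j → Disjoint (U i) (U j))
    {i : ℕ} (hi : i < r) {b : V} (p : G.Walk (u (i + 1)) b) (hp : p.IsPath)
    (hps : ∀ w ∈ p.support, ∃ j, i + 1 ≤ j ∧ j ≤ r ∧ w ∈ U j) :
    ∃ q : G.Walk (u i) b, q.IsPath ∧ q.length = p.length + 1 ∧
      ∀ w ∈ q.support, w = u i ∨ ∃ j, i + 1 ≤ j ∧ j ≤ r ∧ w ∈ U j := by
  refine ⟨.cons (hu.2 i hi) p, ?_, by simp, ?_⟩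
  · rw [Walk.cons_isPath_iff]
    refine ⟨hp, fun hmem => ?_⟩
    obtain ⟨j, hj, -, hj'⟩ := hps _ hmem
    exact Set.disjoint_left.1 (hU i j (by omega)) (hu.1 i hi.le) hj'
  · intro w hw
    rw [Walk.support_cons, List.mem_cons] at hw
    exact hw.imp_right (hps w)

/-- The final segment of a transversal path, as a walk. -/
theorem IsTransversalPath.exists_suffix {V : Type*} {G : SimpleGraph V} {U : ℕ → Set V} {r : ℕ}
    {u : ℕ → V} (hu : IsTransversalPath G U r u) (hU : ∀ i j, i ≠ j → Disjoint (U i) (U j))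
    (k i : ℕ) (hi : i + k = r) :
    ∃ q : G.Walk (u i) (u r), q.IsPath ∧ q.length = k ∧
      ∀ w ∈ q.support, w = u i ∨ ∃ j, i + 1 ≤ j ∧ j ≤ r ∧ w ∈ U j := by
  induction k generalizing i with
  | zero =>
    obtain rfl : i = r := hi
    exact ⟨.nil, by simp, by simp, by simp⟩
  | succ k ih =>
    obtain ⟨p, hp, hpl, hps⟩ := ih (i + 1) (by omega)
    obtain ⟨q, hq, hql, hqs⟩ := hu.exists_cons hU (by omega) p hp fun w hw => by
      rcases hps w hw with rfl | ⟨j, hj, hjr, hw⟩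
      · exact ⟨i + 1, le_rfl, by omega, hu.1 _ (by omega)⟩
      · exact ⟨j, by omega, hjr, hw⟩
    exact ⟨q, hq, by omega, hqs⟩

/-- Prolonging a path backwards along a transversal path to its first vertex. -/
theorem IsTransversalPath.exists_prolongation {V : Type*} {G : SimpleGraph V} {U : ℕ → Set V}
    {r : ℕ} {u : ℕ → V} (hu : IsTransversalPath G U r u)
    (hU : ∀ i j, i ≠ j → Disjoint (U i) (U j))
    (i : ℕ) (hi : i ≤ r) {b : V} (p : G.Walk (u i) b) (hp : p.IsPath)
    (hps : ∀ w ∈ p.support, ∃ j, i ≤ j ∧ j ≤ r ∧ w ∈ U j) :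
    ∃ q : G.Walk (u 0) b, q.IsPath ∧ q.length = p.length + i ∧
      ∀ w ∈ q.support, ∃ j ≤ r, w ∈ U j := by
  induction i with
  | zero => exact ⟨p, hp, rfl, fun w hw => let ⟨j, _, h⟩ := hps w hw; ⟨j, h⟩⟩
  | succ i ih =>
    obtain ⟨q, hq, hql, hqs⟩ := hu.exists_cons hU (by omega) p hp hps
    obtain ⟨q', hq', hql', hqs'⟩ := ih (by omega) q hq fun w hw => by
      rcases hqs w hw with rfl | ⟨j, hj, hjr, hw⟩
      · exact ⟨i, le_rfl, by omega, hu.1 _ (by omega)⟩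
      · exact ⟨j, by omega, hjr, hw⟩
    exact ⟨q', hq', by omega, hqs'⟩

open Finset in
/-- Sets `X`, `Y` of large minimum degree at consecutive levels, whose vertices all lie on
transversal paths, force a long path from the first to the last level. -/
theorem exists_long_path_of_dense_pair {V : Type*} [DecidableEq V] (G : SimpleGraph V)
    [DecidableRel G.Adj] (U : ℕ → Set V) (hU : ∀ i j, i ≠ j → Disjoint (U i) (U j))
    (r c i : ℕ) (hi : i < r) (X Y : Finset V)
    (hXU : ∀ x ∈ X, ∃ u, IsTransversalPath G U r u ∧ u i = x)
    (hYU : ∀ y ∈ Y, ∃ u, IsTransversalPath G U r u ∧ u (i + 1) = y)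
    (hY0 : Y.Nonempty)
    (hX : ∀ x ∈ X, c < #{y ∈ Y | G.Adj x y}) (hY : ∀ y ∈ Y, c < #{x ∈ X | G.Adj y x}) :
    ∃ a ∈ U 0, ∃ b ∈ U r, ∃ p : G.Walk a b, p.IsPath ∧ p.length = r + 2 * c ∧
      ∀ w ∈ p.support, ∃ j ≤ r, w ∈ U j := by
  have hXi : ∀ x ∈ X, x ∈ U i := fun x hx => by
    obtain ⟨u, hu, rfl⟩ := hXU x hx
    exact hu.1 i hi.le
  have hYi : ∀ y ∈ Y, y ∈ U (i + 1) := fun y hy => by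
    obtain ⟨u, hu, rfl⟩ := hYU y hy
    exact hu.1 _ hi
  have hne : ∀ {j k w}, w ∈ U j → w ∈ U k → j = k := fun {j k w} hj hk => by
    by_contra h
    exact Set.disjoint_left.1 (hU j k h) hj hk
  obtain ⟨y, hy⟩ := hY0
  obtain ⟨u, hu, rfl⟩ := hYU y hy
  obtain ⟨q, hq, hql, hqs⟩ := hu.exists_suffix hU (r - (i + 1)) (i + 1) (by omega)
  obtain ⟨x, hx, p, hp, hpl, hps, -, -⟩ := exists_zigzag_path G c X Y
    (Finset.disjoint_left.2 fun w hwX hwY => by have := hne (hXi w hwX) (hYi w hwY); omega)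
    hX hY hy q hq (fun w hw => (hqs w hw).imp_right fun ⟨j, hj, _, hwj⟩ =>
      ⟨fun hwX => by have := hne (hXi w hwX) hwj; omega,
        fun hwY => by have := hne (hYi w hwY) hwj; omega⟩) c le_rfl
  obtain ⟨v, hv, rfl⟩ := hXU x hx
  obtain ⟨p', hp', hpl', hps'⟩ := hv.exists_prolongation hU i hi.le p hp fun w hw => by
    rcases hps w hw with hw | hw | hw
    · exact ⟨i, le_rfl, hi.le, hXi w hw⟩
    · exact ⟨i + 1, by omega, hi, hYi w hw⟩
    · rcases hqs w hw with rfl | ⟨j, hj, hjr, hw⟩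
      · exact ⟨i + 1, by omega, hi, hYi _ hy⟩
      · exact ⟨j, by omega, hjr, hw⟩
  exact ⟨v 0, hv.1 0 (by omega), u r, hu.1 r le_rfl, p', hp', by omega, hps'⟩

/-- The number of paths with `k` edges that start at `v` and then run through
`C (i + 1), …, C (i + k)`. -/
def pathsFrom {V : Type*} (G : SimpleGraph V) [DecidableRel G.Adj] (C : ℕ → Finset V) :
    ℕ → ℕ → V → ℕ
  | 0, _, _ => 1
  | k + 1, i, v => ∑ y ∈ C (i + 1) with G.Adj v y, pathsFrom G C k (i + 1) y

/-- The number of `(C i, …, C (i + k))`-paths. -/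
def pathsThrough {V : Type*} (G : SimpleGraph V) [DecidableRel G.Adj] (C : ℕ → Finset V)
    (k i : ℕ) : ℕ :=
  ∑ v ∈ C i, pathsFrom G C k i v

section counting

open Finset

variable {V : Type*} (G : SimpleGraph V) [DecidableRel G.Adj] (C : ℕ → Finset V)

theorem pathsFrom_succ_le (k i : ℕ) (v : V) :
    pathsFrom G C (k + 1) i v ≤ pathsThrough G C k (i + 1) :=
  sum_le_sum_of_subset (filter_subset _ _)

theorem pathsThrough_add_two_le (k i : ℕ) :
    pathsThrough G C (k + 2) i ≤ pathsThrough G C 1 i * pathsThrough G C k (i + 2) := by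
  simp only [pathsThrough, pathsFrom, sum_mul, one_mul]
  exact sum_le_sum fun v _ => sum_le_sum fun y _ => sum_le_sum_of_subset (filter_subset _ _)

theorem pathsThrough_even_le (r m : ℕ) (hm : ∀ i < r, pathsThrough G C 1 i ≤ m) (k i : ℕ)
    (hk : i + 2 * k ≤ r) :
    pathsThrough G C (2 * k) i ≤ m ^ k * #(C (i + 2 * k)) := by
  induction k generalizing i with
  | zero => simp [pathsThrough, pathsFrom]
  | succ k ih =>
    calc pathsThrough G C (2 * k + 2) i
        ≤ m * (m ^ k * #(C (i + 2 + 2 * k))) :=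
          (pathsThrough_add_two_le G C _ i).trans
            (Nat.mul_le_mul (hm i (by omega)) (ih (i + 2) (by omega)))
      _ = m ^ (k + 1) * #(C (i + 2 * (k + 1))) := by
          rw [show i + 2 * (k + 1) = i + 2 + 2 * k by ring]; ring

theorem pathsThrough_odd_le (r m : ℕ) (hm : ∀ i < r, pathsThrough G C 1 i ≤ m) (k i : ℕ)
    (hk : i + 2 * k < r) :
    pathsThrough G C (2 * k + 1) i ≤ pathsThrough G C 1 i * m ^ k := by
  induction k generalizing i with
  | zero => simp
  | succ k ih =>
    calc pathsThrough G C (2 * k + 1 + 2) i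
        ≤ pathsThrough G C 1 i * (m * m ^ k) :=
          (pathsThrough_add_two_le G C _ i).trans (Nat.mul_le_mul_left _
            ((ih (i + 2) (by omega)).trans (Nat.mul_le_mul_right _ (hm _ (by omega)))))
      _ = pathsThrough G C 1 i * m ^ (k + 1) := by ring

theorem card_paths_le_pathsThrough [Fintype V] (k i : ℕ) :
    Nat.card {u : Fin (k + 1) → V // (∀ j : Fin (k + 1), u j ∈ C (i + j)) ∧
      ∀ j : Fin k, G.Adj (u j.castSucc) (u j.succ)} ≤ pathsThrough G C k i := by
  classical
  have key : ∀ k i v, #{u : Fin (k + 1) → V | u 0 = v ∧ (∀ j : Fin (k + 1), u j ∈ C (i + j)) ∧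
      ∀ j : Fin k, G.Adj (u j.castSucc) (u j.succ)} ≤ pathsFrom G C k i v := by
    intro k
    induction k with
    | zero =>
      intro i v
      refine card_le_one.2 fun u hu w hw => ?_
      simp only [mem_filter, mem_univ, true_and] at hu hw
      ext j
      rw [Fin.fin_one_eq_zero j, hu.1, hw.1]
    | succ k ih =>
      intro i v
      refine le_trans (card_le_card (t := ((C (i + 1)).filter (G.Adj v)).biUnion fun y =>
        ({u : Fin (k + 1) → V | u 0 = y ∧ (∀ j : Fin (k + 1), u j ∈ C (i + 1 + j)) ∧
          ∀ j : Fin k, G.Adj (u j.castSucc) (u j.succ)} : Finset _).image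
            (Fin.cons (α := fun _ => V) v)) ?_) ?_
      · intro u hu
        simp only [mem_filter, mem_univ, true_and] at hu
        obtain ⟨rfl, huC, huG⟩ := hu
        simp only [mem_biUnion, mem_filter, mem_image, mem_univ, true_and]
        refine ⟨u 1, ⟨by simpa using huC 1, huG 0⟩, Fin.tail u,
          ⟨rfl, fun j => ?_, fun j => ?_⟩, Fin.cons_self_tail u⟩
        · have := huC j.succ
          rwa [Fin.val_succ, add_comm (j : ℕ) 1, ← add_assoc] at this
        · exact huG j.succ
      · exact card_biUnion_le.trans (sum_le_sum fun y _ => card_image_le.trans (ih (i + 1) y))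
  rw [Nat.card_eq_fintype_card, Fintype.card_subtype]
  refine le_trans (card_le_card (t := (C i).biUnion fun v =>
    ({u : Fin (k + 1) → V | u 0 = v ∧ (∀ j : Fin (k + 1), u j ∈ C (i + j)) ∧
      ∀ j : Fin k, G.Adj (u j.castSucc) (u j.succ)} : Finset _)) ?_)
    (card_biUnion_le.trans (sum_le_sum fun v _ => key k i v))
  intro u hu
  simp only [mem_filter, mem_univ, true_and] at hu
  simp only [mem_biUnion, mem_filter, mem_univ, true_and]
  exact ⟨u 0, by simpa using hu.1 0, rfl, hu⟩

end counting

theorem stmt5 {V : Type*} [Fintype V] (n s t : ℕ) (hn : Fintype.card V = n)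
    (hs : 2 ≤ s) (hst : s < t) (hpar : s % 2 = t % 2)
    (G : SimpleGraph V) (U : Fin s → Set V)
    (hdisj : ∀ i j, i ≠ j → Disjoint (U i) (U j))
    (hnopath : ¬ ∃ (x y : V) (w : G.Walk x y), w.IsPath ∧ w.length = t - 1 ∧
      x ∈ U ⟨0, by omega⟩ ∧ y ∈ U ⟨s - 1, by omega⟩ ∧
      ∀ v ∈ w.support, ∃ i, v ∈ U i) :
    (Odd s → pCount G U ≤ ((t - s) / 2) ^ ((s - 1) / 2) * n ^ ((s - 3) / 2) *
        ((U ⟨0, by omega⟩).ncard * (U ⟨s - 1, by omega⟩).ncard + ((t - s) / 2) * n)) ∧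
    (Even s → pCount G U ≤ ((t - s) / 2) ^ (s / 2) * n ^ (s / 2 - 1) *
        ((U ⟨0, by omega⟩).ncard + (U ⟨1, by omega⟩).ncard)) := by
  classical
  obtain ⟨r, rfl⟩ : ∃ r, s = r + 1 := ⟨s - 1, by omega⟩
  obtain ⟨c, rfl⟩ : ∃ c, t = r + 1 + 2 * c := ⟨(t - (r + 1)) / 2, by omega⟩
  rw [show (r + 1 + 2 * c - (r + 1)) / 2 = c by omega]
  let W : ℕ → Set V := fun i => if h : i < r + 1 then U ⟨i, h⟩ else ∅
  have hW : ∀ (i : ℕ) (h : i < r + 1), W i = U ⟨i, h⟩ := fun i h => dif_pos h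
  have hWdisj : ∀ i j, i ≠ j → Disjoint (W i) (W j) := by
    intro i j hij
    by_cases hi : i < r + 1
    · by_cases hj : j < r + 1
      · rw [hW i hi, hW j hj]
        exact hdisj _ _ (by simpa using hij)
      · simp only [W, hj, dif_neg, not_false_eq_true, Set.disjoint_empty]
    · simp only [W, hi, dif_neg, not_false_eq_true, Set.empty_disjoint]
  let C : ℕ → Finset V := fun i => {v | ∃ u, IsTransversalPath G W r u ∧ u i = v}
  have hC : ∀ i v, v ∈ C i ↔ ∃ u, IsTransversalPath G W r u ∧ u i = v := by simp [C]
  have hCW : ∀ i ≤ r, ∀ v ∈ C i, v ∈ W i := by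
    intro i hi v hv
    obtain ⟨u, hu, rfl⟩ := (hC i v).1 hv
    exact hu.1 i hi
  have hcard : ∀ (i : ℕ) (h : i < r + 1), (C i).card ≤ (U ⟨i, h⟩).ncard := by
    intro i h
    rw [← Set.ncard_coe_finset]
    exact Set.ncard_le_ncard (fun v hv => hW i h ▸ hCW i (by omega) v hv) (Set.toFinite _)
  have hcore : ∀ i < r, ∀ X' ⊆ C i, ∀ Y' ⊆ C (i + 1), X'.Nonempty → Y'.Nonempty →
      (∀ x ∈ X', c < (Y'.filter (G.Adj x)).card) →
        ¬ ∀ y ∈ Y', c < (X'.filter (G.Adj y)).card := by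
    intro i hi X hX Y hY _ hY0 hXc hYc
    obtain ⟨a, ha, b, hb, p, hp, hpl, hps⟩ := exists_long_path_of_dense_pair G W hWdisj r c i hi
      X Y (fun x hx => (hC _ _).1 (hX hx)) (fun y hy => (hC _ _).1 (hY hy)) hY0 hXc hYc
    refine hnopath ⟨a, b, p, hp, by omega, hW 0 (by omega) ▸ ha, hW r (by omega) ▸ hb, ?_⟩
    intro v hv
    obtain ⟨j, hj, hvj⟩ := hps v hv
    exact ⟨⟨j, by omega⟩, hW j (by omega) ▸ hvj⟩
  have hedge : ∀ i < r, pathsThrough G C 1 i ≤ c * ((C i).card + (C (i + 1)).card) := by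
    intro i hi
    have := sum_weight_le_of_no_dense_pair G c 1 (fun _ => 1) (C i) (C (i + 1)) (hcore i hi)
      (fun _ _ => le_rfl)
    simpa [pathsThrough, pathsFrom, mul_add] using this
  have hm : ∀ i < r, pathsThrough G C 1 i ≤ c * n := by
    intro i hi
    refine (hedge i hi).trans (Nat.mul_le_mul_left _ ?_)
    rw [← Finset.card_union_of_disjoint, ← hn]
    · exact Finset.card_le_univ _
    · refine Finset.disjoint_left.2 fun v hv hv' => ?_
      exact Set.disjoint_left.1 (hWdisj i (i + 1) (by omega)) (hCW i hi.le v hv)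
        (hCW (i + 1) hi v hv')
  have hp : pCount G U ≤ pathsThrough G C r 0 := by
    refine le_trans (Nat.card_le_card_of_injective (Subtype.map id fun u hu => ⟨fun j => ?_,
      fun j => hu.2 j (by omega)⟩) (Subtype.map_injective _ Function.injective_id))
      (card_paths_le_pathsThrough G C r 0)
    refine (hC _ _).2 ⟨fun i => if h : i < r + 1 then u ⟨i, h⟩ else u 0,
      ⟨fun i hi => ?_, fun i hi => ?_⟩, by simp only [zero_add, j.isLt, dif_pos, id, Fin.eta]⟩
    · have hi' : i < r + 1 := by omega
      simp only [hi', dif_pos, hW i hi']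
      exact hu.1 _
    · have hi' : i < r + 1 := by omega
      have hi'' : i + 1 < r + 1 := by omega
      simp only [hi', hi'', dif_pos]
      exact hu.2 i hi''
  constructor
  · intro hodd
    obtain ⟨k, hk⟩ : ∃ k, r = 2 * k + 2 := by
      obtain ⟨k, hk⟩ := hodd
      exact ⟨k - 1, by omega⟩
    subst hk
    refine hp.trans ?_
    have hsum := sum_weight_le_of_no_dense_pair G c ((c * n) ^ k * (C (2 * k + 2)).card)
      (pathsFrom G C (2 * k + 1) 1) (C 0) (C 1) (hcore 0 (by omega)) (fun y _ => by
        refine (pathsFrom_succ_le G C (2 * k) 1 y).trans ?_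
        have := pathsThrough_even_le G C (2 * k + 2) (c * n) hm k 2 (by omega)
        rwa [add_comm 2 (2 * k)] at this)
    have htail : pathsThrough G C (2 * k + 1) 1 ≤ c * n * (c * n) ^ k :=
      (pathsThrough_odd_le G C (2 * k + 2) (c * n) hm k 1 (by omega)).trans
        (Nat.mul_le_mul_right _ (hm 1 (by omega)))
    have h0 := hcard 0 (by omega)
    have h1 := hcard (2 * k + 2) (by omega)
    rw [show (2 * k + 2 + 1 - 1) / 2 = k + 1 by omega, show (2 * k + 2 + 1 - 3) / 2 = k by omega]
    calc pathsThrough G C (2 * k + 2) 0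
        ≤ c * ((C 0).card * ((c * n) ^ k * (C (2 * k + 2)).card))
          + c * pathsThrough G C (2 * k + 1) 1 := hsum
      _ ≤ c * ((U ⟨0, by omega⟩).ncard * ((c * n) ^ k * (U ⟨2 * k + 2, by omega⟩).ncard))
          + c * (c * n * (c * n) ^ k) := by gcongr
      _ = _ := by simp only [Nat.add_sub_cancel]; ring
  · intro heven
    obtain ⟨k, hk⟩ : ∃ k, r = 2 * k + 1 := by
      obtain ⟨k, hk⟩ := heven
      exact ⟨k - 1, by omega⟩
    subst hk
    rw [show (2 * k + 1 + 1) / 2 = k + 1 by omega, Nat.add_sub_cancel]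
    have h0 := hcard 0 (by omega)
    have h1 := hcard 1 (by omega)
    calc pCount G U ≤ pathsThrough G C 1 0 * (c * n) ^ k :=
          hp.trans (pathsThrough_odd_le G C (2 * k + 1) (c * n) hm k 0 (by omega))
      _ ≤ c * ((C 0).card + (C 1).card) * (c * n) ^ k :=
          Nat.mul_le_mul_right _ (hedge 0 (by omega))
      _ ≤ c * ((U ⟨0, by omega⟩).ncard + (U ⟨1, by omega⟩).ncard) * (c * n) ^ k := by gcongr
      _ = _ := by ring
end

section
/- Let k ≥ 2, ℓ ≥ 2, let G be an n-vertex graph, and assume either that G contains no cycle of length 2ℓ, or that G contains no cycle of length 2ℓ+1 and ℓ > k. Then for every partition V(G) = V_1 ∪ ⋯ ∪ V_{2k+1}, the number of (V_1,…,V_{2k+1})-cycles satisfies c(V_1,…,V_{2k+1}) ≤ ℓ^{k−1} n^{k−2} · [p(V_1,V_2,V_3,V_4) + p(V_{2k+1},V_1,V_2,V_3)]. -/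
open SimpleGraph

lemma exists_walk_support_eq_map_range {V : Type*} {G : SimpleGraph V} (f : ℕ → V) (m : ℕ)
    (hadj : ∀ i < m, G.Adj (f i) (f (i + 1))) :
    ∃ p : G.Walk (f 0) (f m), p.length = m ∧ p.support = (List.range (m + 1)).map f := by
  induction m with
  | zero => exact ⟨Walk.nil, rfl, by simp⟩
  | succ m ih =>
    obtain ⟨p, hlen, hsupp⟩ := ih fun i hi => hadj i (by omega)
    refine ⟨p.concat (hadj m (by omega)), by simp [hlen], ?_⟩
    rw [Walk.support_concat, hsupp, List.range_succ (n := m + 1)]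
    simp

lemma exists_isCycle_of_injOn {V : Type*} {G : SimpleGraph V} (f : ℕ → V) (m : ℕ) (hm : 2 ≤ m)
    (hadj : ∀ i < m, G.Adj (f i) (f (i + 1))) (hclose : G.Adj (f m) (f 0))
    (hinj : ∀ a ≤ m, ∀ b ≤ m, f a = f b → a = b) :
    ∃ (v : V) (w : G.Walk v v), w.IsCycle ∧ w.length = m + 1 := by
  obtain ⟨p, hlen, hsupp⟩ := exists_walk_support_eq_map_range f m hadj
  have hp : p.IsPath := by
    rw [Walk.isPath_def, hsupp]
    refine List.Nodup.map_on ?_ List.nodup_range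
    intro a ha b hb h
    rw [List.mem_range] at ha hb
    exact hinj a (by omega) b (by omega) h
  refine ⟨_, Walk.cons hclose p, ?_, by simp [hlen]⟩
  rw [Walk.cons_isCycle_iff]
  refine ⟨hp, fun h => ?_⟩
  have := hp.length_eq_one_of_mem_edges (by rwa [Sym2.eq_swap])
  omega

open Classical in
lemma exists_subset_degree_gt {α β : Type*} (t : ℕ) (H : Finset (α × β))
    (hH : t * ((H.image Prod.fst).card + (H.image Prod.snd).card) < H.card) :
    ∃ H' ⊆ H, H'.Nonempty ∧ (∀ e ∈ H', t < (H'.filter fun p => p.1 = e.1).card) ∧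
      ∀ e ∈ H', t < (H'.filter fun p => p.2 = e.2).card := by
  induction H using Finset.strongInduction with
  | H H ih =>
    by_cases h1 : ∀ e ∈ H, t < (H.filter fun p => p.1 = e.1).card
    · by_cases h2 : ∀ e ∈ H, t < (H.filter fun p => p.2 = e.2).card
      · exact ⟨H, subset_rfl, Finset.card_pos.mp (by omega), h1, h2⟩
      · push Not at h2
        obtain ⟨e, he, hdeg⟩ := h2
        have hsplit := Finset.card_filter_add_card_filter_not (s := H) fun p => p.2 = e.2
        have hfst : ((H.filter fun p => ¬ p.2 = e.2).image Prod.fst).card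
            ≤ (H.image Prod.fst).card :=
          Finset.card_le_card (Finset.image_subset_image (Finset.filter_subset _ _))
        have hsnd : ((H.filter fun p => ¬ p.2 = e.2).image Prod.snd).card + 1
            ≤ (H.image Prod.snd).card := by
          refine Finset.card_lt_card ⟨Finset.image_subset_image (Finset.filter_subset _ _), ?_⟩
          intro h
          have := h (Finset.mem_image_of_mem Prod.snd he)
          simp at this
        obtain ⟨H', hsub, hrest⟩ := ih (H.filter fun p => ¬ p.2 = e.2)
          (Finset.filter_ssubset.2 ⟨e, he, by simp⟩) (by nlinarith)
        exact ⟨H', hsub.trans (Finset.filter_subset _ _), hrest⟩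
    · push Not at h1
      obtain ⟨e, he, hdeg⟩ := h1
      have hsplit := Finset.card_filter_add_card_filter_not (s := H) fun p => p.1 = e.1
      have hsnd : ((H.filter fun p => ¬ p.1 = e.1).image Prod.snd).card
          ≤ (H.image Prod.snd).card :=
        Finset.card_le_card (Finset.image_subset_image (Finset.filter_subset _ _))
      have hfst : ((H.filter fun p => ¬ p.1 = e.1).image Prod.fst).card + 1
          ≤ (H.image Prod.fst).card := by
        refine Finset.card_lt_card ⟨Finset.image_subset_image (Finset.filter_subset _ _), ?_⟩
        intro h
        have := h (Finset.mem_image_of_mem Prod.fst he)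
        simp at this
      obtain ⟨H', hsub, hrest⟩ := ih (H.filter fun p => ¬ p.1 = e.1)
        (Finset.filter_ssubset.2 ⟨e, he, by simp⟩) (by nlinarith)
      exact ⟨H', hsub.trans (Finset.filter_subset _ _), hrest⟩

open Classical in
lemma exists_alternating_path_of_degree_gt {α : Type*} (t : ℕ) (H : Finset (α × α))
    (hne : H.Nonempty) (hfst : ∀ e ∈ H, t < (H.filter fun p => p.1 = e.1).card)
    (hsnd : ∀ e ∈ H, t < (H.filter fun p => p.2 = e.2).card) (m : ℕ) (hm : m ≤ t) :
    ∃ (x : ℕ → α) (y : ℕ → α), (∀ i ≤ m, (x i, y i) ∈ H) ∧ (∀ i < m, (x (i + 1), y i) ∈ H) ∧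
      (∀ a ≤ m, ∀ b ≤ m, x a = x b → a = b) ∧ ∀ a ≤ m, ∀ b ≤ m, y a = y b → a = b := by
  induction m with
  | zero =>
    obtain ⟨e, he⟩ := hne
    exact ⟨fun _ => e.1, fun _ => e.2, fun _ _ => he, by simp, by omega, by omega⟩
  | succ m ih =>
    obtain ⟨x, y, hxy, hyx, hx, hy⟩ := ih (by omega)
    have hused (z : ℕ → α) : ((Finset.range (m + 1)).image z).card < t + 1 :=
      Finset.card_image_le.trans_lt (by simp; omega)
    obtain ⟨x', hx', hxnew⟩ : ∃ x', (x', y m) ∈ H ∧ ∀ i ≤ m, x i ≠ x' := by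
      have hcard : (H.filter fun p => p.2 = y m).card
          = ((H.filter fun p => p.2 = y m).image Prod.fst).card := by
        refine (Finset.card_image_of_injOn ?_).symm
        rintro ⟨a, b⟩ ha ⟨c, d⟩ hc h
        simp_all
      obtain ⟨x', h1, h2⟩ := Finset.exists_mem_notMem_of_card_lt_card
        ((hused x).trans_le (Nat.succ_le_of_lt ((hsnd _ (hxy m le_rfl)).trans_eq hcard)))
      simp only [Finset.mem_image, Finset.mem_filter, Finset.mem_range, Prod.exists] at h1 h2
      obtain ⟨a, b, ⟨hab, rfl⟩, rfl⟩ := h1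
      exact ⟨a, hab, fun i hi h => h2 ⟨i, by omega, h⟩⟩
    obtain ⟨y', hy', hynew⟩ : ∃ y', (x', y') ∈ H ∧ ∀ i ≤ m, y i ≠ y' := by
      have hcard : (H.filter fun p => p.1 = x').card
          = ((H.filter fun p => p.1 = x').image Prod.snd).card := by
        refine (Finset.card_image_of_injOn ?_).symm
        rintro ⟨a, b⟩ ha ⟨c, d⟩ hc h
        simp_all
      obtain ⟨y', h1, h2⟩ := Finset.exists_mem_notMem_of_card_lt_card
        ((hused y).trans_le (Nat.succ_le_of_lt ((hfst _ hx').trans_eq hcard)))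
      simp only [Finset.mem_image, Finset.mem_filter, Finset.mem_range, Prod.exists] at h1 h2
      obtain ⟨a, b, ⟨hab, rfl⟩, rfl⟩ := h1
      exact ⟨b, hab, fun i hi h => h2 ⟨i, by omega, h⟩⟩
    refine ⟨fun i => if i ≤ m then x i else x', fun i => if i ≤ m then y i else y', ?_, ?_, ?_, ?_⟩
    · intro i hi
      by_cases h : i ≤ m <;> simp [h, hxy, hy']
    · intro i hi
      rcases Nat.lt_succ_iff_lt_or_eq.mp hi with h | rfl
      · simp [h.le, Nat.succ_le_of_lt h, hyx i h]
      · simp [hx']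
    · intro a ha b hb h
      by_cases h1 : a ≤ m <;> by_cases h2 : b ≤ m <;> simp only [h1, h2, if_true, if_false] at h
      · exact hx a h1 b h2 h
      · exact absurd h (hxnew a h1)
      · exact absurd h.symm (hxnew b h2)
      · omega
    · intro a ha b hb h
      by_cases h1 : a ≤ m <;> by_cases h2 : b ≤ m <;> simp only [h1, h2, if_true, if_false] at h
      · exact hy a h1 b h2 h
      · exact absurd h (hynew a h1)
      · exact absurd h.symm (hynew b h2)
      · omega

/-- Closing an alternating path `x 0, y 0, x 1, …, x q` with a single vertex, or an alternating path
`x 0, y 0, …, x q, y q` with the rest of a `(2 * k + 1)`-cycle through `x q, y q`. -/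
lemma alternating_path_not_long {V : Type*} {G : SimpleGraph V} {k l : ℕ} (hk : 2 ≤ k) (hl : 2 ≤ l)
    (hfree : CycleFree G (2 * l) ∨ (CycleFree G (2 * l + 1) ∧ k < l))
    (U : Fin (2 * k + 1) → Set V) (hdisj : ∀ i j, i ≠ j → Disjoint (U i) (U j)) (j : ℕ) (w : V)
    (x y : ℕ → V)
    (hxy : ∀ i ≤ l, ∃ u : Fin (2 * k + 1) → V, (∀ i, u i ∈ U i) ∧
      (∀ t, G.Adj (u (Fin.ofNat _ t)) (u (Fin.ofNat _ (t + 1)))) ∧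
      u (Fin.ofNat _ (j + 2)) = w ∧ u (Fin.ofNat _ (j + 1)) = x i ∧ u (Fin.ofNat _ j) = y i)
    (hyx : ∀ i < l, G.Adj (y i) (x (i + 1)))
    (hx : ∀ a ≤ l, ∀ b ≤ l, x a = x b → a = b) (hy : ∀ a ≤ l, ∀ b ≤ l, y a = y b → a = b) :
    False := by
  have hclass : ∀ v a b, j ≤ a → a ≤ j + 2 * k → j ≤ b → b ≤ j + 2 * k →
      v ∈ U (Fin.ofNat _ a) → v ∈ U (Fin.ofNat _ b) → a = b := by
    intro v a b ha ha' hb hb' hva hvb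
    have hab : Fin.ofNat (2 * k + 1) a = Fin.ofNat (2 * k + 1) b := by
      by_contra hne
      exact Set.disjoint_left.mp (hdisj _ _ hne) hva hvb
    have hmod : a ≡ b [MOD 2 * k + 1] := congrArg Fin.val hab
    rcases le_total a b with h | h
    · have := (Nat.modEq_iff_dvd' h).mp hmod
      have := Nat.eq_zero_of_dvd_of_lt this (by omega)
      omega
    · have := (Nat.modEq_iff_dvd' h).mp hmod.symm
      have := Nat.eq_zero_of_dvd_of_lt this (by omega)
      omega
  have hxmem : ∀ i ≤ l, x i ∈ U (Fin.ofNat _ (j + 1)) := by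
    intro i hi
    obtain ⟨u, hu, -, -, h, -⟩ := hxy i hi
    exact h ▸ hu _
  have hymem : ∀ i ≤ l, y i ∈ U (Fin.ofNat _ j) := by
    intro i hi
    obtain ⟨u, hu, -, -, -, h⟩ := hxy i hi
    exact h ▸ hu _
  have hadj : ∀ i ≤ l, G.Adj (y i) (x i) := by
    intro i hi
    obtain ⟨u, -, hu, -, h, h'⟩ := hxy i hi
    exact h ▸ h' ▸ hu j
  have hxw : ∀ i ≤ l, G.Adj (x i) w := by
    intro i hi
    obtain ⟨u, -, hu, h, h', -⟩ := hxy i hi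
    exact h ▸ h' ▸ hu (j + 1)
  have hw : w ∈ U (Fin.ofNat _ (j + 2)) := by
    obtain ⟨u, hu, -, h, -⟩ := hxy 0 (by omega)
    exact h ▸ hu _
  rcases hfree with hfree | ⟨hfree, hkl⟩
  · let f : ℕ → V := fun i =>
      if i < 2 * l - 1 then if i % 2 = 0 then x (i / 2) else y (i / 2) else w
    let c : ℕ → ℕ := fun i => if i < 2 * l - 1 then if i % 2 = 0 then j + 1 else j else j + 2
    have hfc : ∀ i, f i ∈ U (Fin.ofNat _ (c i)) := by
      intro i
      simp only [f, c]
      split_ifs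
      · exact hxmem _ (by omega)
      · exact hymem _ (by omega)
      · exact hw
    obtain ⟨v, p, hp, hlen⟩ := exists_isCycle_of_injOn (G := G) f (2 * l - 1) (by omega)
      (by
        intro i hi
        by_cases hlast : i + 1 < 2 * l - 1
        · rcases Nat.mod_two_eq_zero_or_one i with h | h
          · have h1 : (i + 1) % 2 ≠ 0 := by omega
            have h2 : (i + 1) / 2 = i / 2 := by omega
            simp only [f, hi, hlast, h, h1, h2, if_true, if_false]
            exact (hadj _ (by omega)).symm
          · have h1 : (i + 1) % 2 = 0 := by omega
            have h2 : (i + 1) / 2 = i / 2 + 1 := by omega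
            have h3 : i % 2 ≠ 0 := by omega
            simp only [f, hi, hlast, h1, h2, h3, if_true, if_false]
            exact hyx _ (by omega)
        · have h : i % 2 = 0 := by omega
          simp only [f, hi, hlast, h, if_true, if_false]
          exact hxw _ (by omega))
      (by
        have h : 0 < 2 * l - 1 := by omega
        simp only [f, h, lt_irrefl, Nat.zero_mod, Nat.zero_div, if_true, if_false]
        exact (hxw 0 (by omega)).symm)
      (by
        intro a ha b hb hab
        have hc := hclass (f a) (c a) (c b) (by simp only [c]; split_ifs <;> omega)
          (by simp only [c]; split_ifs <;> omega) (by simp only [c]; split_ifs <;> omega)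
          (by simp only [c]; split_ifs <;> omega) (hfc a) (hab ▸ hfc b)
        simp only [f, c] at hab hc
        split_ifs at hab hc <;> try omega
        · have := hx _ (by omega) _ (by omega) hab
          omega
        · have := hy _ (by omega) _ (by omega) hab
          omega)
    exact hfree p hp (by omega)
  · obtain ⟨q, rfl⟩ : ∃ q, l = q + k := ⟨l - k, by omega⟩
    obtain ⟨u, hu, huadj, huw, hux, huy⟩ := hxy q (by omega)
    let f : ℕ → V := fun i =>
      if i < 2 * q + 2 then if i % 2 = 0 then x (i / 2) else y (i / 2)
      else u (Fin.ofNat _ (j + 2 * k - (i - (2 * q + 2))))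
    let c : ℕ → ℕ := fun i =>
      if i < 2 * q + 2 then if i % 2 = 0 then j + 1 else j else j + 2 * k - (i - (2 * q + 2))
    have hfc : ∀ i ≤ 2 * (q + k), f i ∈ U (Fin.ofNat _ (c i)) := by
      intro i hi
      simp only [f, c]
      split_ifs
      · exact hxmem _ (by omega)
      · exact hymem _ (by omega)
      · exact hu _
    obtain ⟨v, p, hp, hlen⟩ := exists_isCycle_of_injOn (G := G) f (2 * (q + k)) (by omega)
      (by
        intro i hi
        by_cases hlast : i + 1 < 2 * q + 2
        · have hi' : i < 2 * q + 2 := by omega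
          rcases Nat.mod_two_eq_zero_or_one i with h | h
          · have h1 : (i + 1) % 2 ≠ 0 := by omega
            have h2 : (i + 1) / 2 = i / 2 := by omega
            simp only [f, hi', hlast, h, h1, h2, if_true, if_false]
            exact (hadj _ (by omega)).symm
          · have h1 : (i + 1) % 2 = 0 := by omega
            have h2 : (i + 1) / 2 = i / 2 + 1 := by omega
            have h3 : i % 2 ≠ 0 := by omega
            simp only [f, hi', hlast, h1, h2, h3, if_true, if_false]
            exact hyx _ (by omega)
        · by_cases hi' : i < 2 * q + 2
          · obtain rfl : i = 2 * q + 1 := by omega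
            have h1 : (2 * q + 1) % 2 ≠ 0 := by omega
            have h2 : (2 * q + 1) / 2 = q := by omega
            simp only [f, hi', hlast, h1, h2, if_true, if_false]
            rw [← huy]
            have h3 : Fin.ofNat (2 * k + 1) j = Fin.ofNat (2 * k + 1) (j + 2 * k + 1) := by
              apply Fin.ext
              simp [add_assoc]
            rw [h3]
            simpa using (huadj (j + 2 * k)).symm
          · simp only [f, hi', hlast, if_false]
            have h := huadj (j + 2 * k - (i + 1 - (2 * q + 2)))
            rw [show j + 2 * k - (i + 1 - (2 * q + 2)) + 1 = j + 2 * k - (i - (2 * q + 2)) by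
              omega] at h
            exact h.symm)
      (by
        have h : 0 < 2 * q + 2 := by omega
        have h' : ¬ 2 * (q + k) < 2 * q + 2 := by omega
        simp only [f, h, h', Nat.zero_mod, Nat.zero_div, if_true, if_false]
        rw [show j + 2 * k - (2 * (q + k) - (2 * q + 2)) = j + 2 by omega, huw]
        exact (hxw 0 (by omega)).symm)
      (by
        intro a ha b hb hab
        have hc := hclass (f a) (c a) (c b) (by simp only [c]; split_ifs <;> omega)
          (by simp only [c]; split_ifs <;> omega) (by simp only [c]; split_ifs <;> omega)
          (by simp only [c]; split_ifs <;> omega) (hfc a ha) (hab ▸ hfc b hb)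
        simp only [f, c] at hab hc
        split_ifs at hab hc <;> try omega
        · have := hx _ (by omega) _ (by omega) hab
          omega
        · have := hy _ (by omega) _ (by omega) hab
          omega)
    exact hfree p hp (by omega)

/-- The `(U 0, …, U (2 * k))`-cycles of `G`. -/
def cycleTuples {V : Type*} (G : SimpleGraph V) {k : ℕ} (U : Fin (2 * k + 1) → Set V) :
    Set (Fin (2 * k + 1) → V) :=
  {u | (∀ i, u i ∈ U i) ∧ ∀ t, G.Adj (u (Fin.ofNat _ t)) (u (Fin.ofNat _ (t + 1)))}

open Classical in
lemma card_image_pair_le {V : Type*} {G : SimpleGraph V} {k l : ℕ} (hk : 2 ≤ k)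
    (hl : 2 ≤ l) (hfree : CycleFree G (2 * l) ∨ (CycleFree G (2 * l + 1) ∧ k < l))
    (U : Fin (2 * k + 1) → Set V) (hdisj : ∀ i j, i ≠ j → Disjoint (U i) (U j)) (j : ℕ) (w : V)
    (D : Finset (Fin (2 * k + 1) → V)) (hD : ∀ u ∈ D, u ∈ cycleTuples G U)
    (hw : ∀ u ∈ D, u (Fin.ofNat _ (j + 2)) = w) :
    (D.image fun u => (u (Fin.ofNat _ (j + 1)), u (Fin.ofNat _ j))).card ≤
      l * ((D.image fun u => u (Fin.ofNat _ (j + 1))).card +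
        (D.image fun u => u (Fin.ofNat _ j)).card) := by
  by_contra! hlt
  obtain ⟨H, hH, hne, hfst, hsnd⟩ := exists_subset_degree_gt l
    (D.image fun u => (u (Fin.ofNat _ (j + 1)), u (Fin.ofNat _ j)))
    (by simpa only [Finset.image_image, Function.comp_def] using hlt)
  obtain ⟨x, y, hxy, hyx, hx, hy⟩ :=
    exists_alternating_path_of_degree_gt l H hne hfst hsnd l le_rfl
  have hmem : ∀ a b, (a, b) ∈ H → ∃ u ∈ D, u (Fin.ofNat _ (j + 1)) = a ∧ u (Fin.ofNat _ j) = b := by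
    intro a b hab
    simpa using hH hab
  refine alternating_path_not_long hk hl hfree U hdisj j w x y ?_ ?_ hx hy
  · intro i hi
    obtain ⟨u, hu, h1, h2⟩ := hmem _ _ (hxy i hi)
    exact ⟨u, (hD u hu).1, (hD u hu).2, hw u hu, h1, h2⟩
  · intro i hi
    obtain ⟨u, hu, h1, h2⟩ := hmem _ _ (hyx i hi)
    exact h1 ▸ h2 ▸ (hD u hu).2 j

lemma card_image_eq_sum_fiberwise {α β γ : Type*} [DecidableEq β] [DecidableEq γ] (C : Finset α) (g : α → β) (h : α → γ) :
    (C.image fun a => (g a, h a)).card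
      = ∑ b ∈ C.image g, ((C.filter fun a => g a = b).image h).card := by
  rw [Finset.card_eq_sum_card_fiberwise (f := Prod.fst) (t := C.image g)]
  · refine Finset.sum_congr rfl fun b _ => ?_
    refine Finset.card_bij' (fun p _ => p.2) (fun c _ => (b, c)) ?_ ?_ ?_ ?_
    · rintro ⟨p, q⟩ hp
      simp only [Finset.mem_filter, Finset.mem_image, Prod.mk.injEq] at hp ⊢
      obtain ⟨⟨a, ha, rfl, rfl⟩, rfl⟩ := hp
      exact ⟨a, ⟨ha, rfl⟩, rfl⟩
    · intro c hc
      simp only [Finset.mem_filter, Finset.mem_image, Prod.mk.injEq] at hc ⊢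
      obtain ⟨a, ⟨ha, rfl⟩, rfl⟩ := hc
      exact ⟨⟨a, ha, rfl, rfl⟩, trivial⟩
    · rintro ⟨p, q⟩ hp
      simp only [Finset.mem_filter] at hp
      simp [hp.2]
    · simp
  · intro p hp
    simp only [Finset.coe_image, Set.mem_image, Finset.mem_coe] at hp ⊢
    obtain ⟨a, ha, rfl⟩ := hp
    exact ⟨a, ha, rfl⟩

lemma card_image_le_of_determined {α β γ : Type*} [DecidableEq β] [DecidableEq γ] (C : Finset α) (f : α → β) (g : α → γ)
    (h : ∀ a ∈ C, ∀ b ∈ C, g a = g b → f a = f b) : (C.image f).card ≤ (C.image g).card := by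
  calc (C.image f).card = ((C.image fun a => (f a, g a)).image Prod.fst).card := by
        rw [Finset.image_image]; rfl
    _ ≤ (C.image fun a => (f a, g a)).card := Finset.card_image_le
    _ = ((C.image fun a => (f a, g a)).image Prod.snd).card := by
        refine (Finset.card_image_of_injOn fun p hp q hq hpq => ?_).symm
        simp only [Finset.coe_image, Set.mem_image, Finset.mem_coe] at hp hq
        obtain ⟨a, ha, rfl⟩ := hp
        obtain ⟨b, hb, rfl⟩ := hq
        exact Prod.ext (h a ha b hb hpq) hpq
    _ = (C.image g).card := by rw [Finset.image_image]; rfl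

open Classical in
/-- The number of distinct restrictions to the coordinates in `S` of the tuples in `C`. -/
noncomputable def projCard {ι V : Type*} (C : Finset (ι → V)) (S : Set ι) : ℕ :=
  (C.image S.domRestrict).card

lemma projCard_le_card_image {ι V β : Type*} [DecidableEq β] (C : Finset (ι → V)) (S : Set ι)
    (g : (ι → V) → β) (h : ∀ u ∈ C, ∀ v ∈ C, g u = g v → Set.EqOn u v S) :
    projCard C S ≤ (C.image g).card := by
  classical
  exact card_image_le_of_determined _ _ _ fun u hu v hv huv =>
    Set.domRestrict_eq_domRestrict_iff.mpr (h u hu v hv huv)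

lemma projCard_univ {ι V : Type*} (C : Finset (ι → V)) : projCard C Set.univ = C.card := by
  classical
  refine Finset.card_image_of_injective _ fun u v h => ?_
  rw [Set.domRestrict_eq_domRestrict_iff] at h
  exact funext fun i => h (Set.mem_univ i)

open Classical in
lemma projCard_insert {ι V : Type*} (C : Finset (ι → V)) (S : Set ι) (a : ι) :
    projCard C (insert a S) = (C.image fun u => (S.domRestrict u, u a)).card := by
  apply le_antisymm <;> refine card_image_le_of_determined _ _ _ fun u _ v _ h => ?_
  · simp only [Prod.mk.injEq, Set.domRestrict_eq_domRestrict_iff] at h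
    rw [Set.domRestrict_eq_domRestrict_iff]
    rintro i (rfl | hi)
    exacts [h.2, h.1 hi]
  · rw [Set.domRestrict_eq_domRestrict_iff] at h
    simp only [Prod.mk.injEq, Set.domRestrict_eq_domRestrict_iff]
    exact ⟨fun i hi => h (Or.inr hi), h (Or.inl rfl)⟩

open Classical in
lemma projCard_insert_insert {ι V : Type*} (C : Finset (ι → V)) (S : Set ι) (a b : ι) :
    projCard C (insert a (insert b S)) = (C.image fun u => (S.domRestrict u, (u a, u b))).card := by
  apply le_antisymm <;> refine card_image_le_of_determined _ _ _ fun u _ v _ h => ?_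
  · simp only [Prod.mk.injEq, Set.domRestrict_eq_domRestrict_iff] at h
    rw [Set.domRestrict_eq_domRestrict_iff]
    rintro i (rfl | rfl | hi)
    exacts [h.2.1, h.2.2, h.1 hi]
  · rw [Set.domRestrict_eq_domRestrict_iff] at h
    simp only [Prod.mk.injEq, Set.domRestrict_eq_domRestrict_iff]
    exact ⟨fun i hi => h (Or.inr (Or.inr hi)), h (Or.inl rfl), h (Or.inr (Or.inl rfl))⟩

open Classical in
lemma projCard_insert_le {ι V : Type*} (C : Finset (ι → V)) (S : Set ι) (a : ι) :
    projCard C (insert a S) ≤ projCard C S * (C.image fun u => u a).card := by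
  rw [projCard_insert, projCard, ← Finset.card_product]
  refine Finset.card_le_card fun p hp => ?_
  obtain ⟨u, hu, rfl⟩ := Finset.mem_image.mp hp
  exact Finset.mk_mem_product (Finset.mem_image_of_mem _ hu) (Finset.mem_image_of_mem _ hu)

open Classical in
lemma projCard_insert_insert_le_of_forall_fiber {ι V : Type*} (C : Finset (ι → V)) (S : Set ι)
    (a b : ι) (l : ℕ)
    (h : ∀ D ⊆ C, (∀ u ∈ D, ∀ v ∈ D, Set.EqOn u v S) →
      (D.image fun u => (u a, u b)).card ≤
        l * ((D.image fun u => u a).card + (D.image fun u => u b).card)) :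
    projCard C (insert a (insert b S)) ≤
      l * (projCard C (insert a S) + projCard C (insert b S)) := by
  rw [projCard_insert_insert, projCard_insert, projCard_insert, card_image_eq_sum_fiberwise,
    card_image_eq_sum_fiberwise, card_image_eq_sum_fiberwise, ← Finset.sum_add_distrib,
    Finset.mul_sum]
  refine Finset.sum_le_sum fun s _ => h _ (Finset.filter_subset _ _) fun u hu v hv => ?_
  rw [← Set.domRestrict_eq_domRestrict_iff, (Finset.mem_filter.mp hu).2,
    (Finset.mem_filter.mp hv).2]

lemma projCard_insert_pair_le {V : Type*} {G : SimpleGraph V} {k l : ℕ} (hk : 2 ≤ k)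
    (hl : 2 ≤ l) (hfree : CycleFree G (2 * l) ∨ (CycleFree G (2 * l + 1) ∧ k < l))
    (U : Fin (2 * k + 1) → Set V) (hdisj : ∀ i j, i ≠ j → Disjoint (U i) (U j)) (j : ℕ)
    (C : Finset (Fin (2 * k + 1) → V)) (hC : ∀ u ∈ C, u ∈ cycleTuples G U)
    (S : Set (Fin (2 * k + 1))) (hS : Fin.ofNat _ (j + 2) ∈ S) :
    projCard C (insert (Fin.ofNat _ (j + 1)) (insert (Fin.ofNat _ j) S)) ≤
      l * (projCard C (insert (Fin.ofNat _ (j + 1)) S) + projCard C (insert (Fin.ofNat _ j) S)) := by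
  refine projCard_insert_insert_le_of_forall_fiber C S _ _ l fun D hDC hD => ?_
  rcases D.eq_empty_or_nonempty with rfl | ⟨w, hw⟩
  · simp
  · exact card_image_pair_le hk hl hfree U hdisj j (w (Fin.ofNat _ (j + 2))) D
      (fun u hu => hC u (hDC hu)) fun u hu => hD u hu w hw hS

lemma projCard_insert_pair_le_mul {V : Type*} [Fintype V] {G : SimpleGraph V} {k l : ℕ}
    (hk : 2 ≤ k) (hl : 2 ≤ l)
    (hfree : CycleFree G (2 * l) ∨ (CycleFree G (2 * l + 1) ∧ k < l))
    (U : Fin (2 * k + 1) → Set V) (hdisj : ∀ i j, i ≠ j → Disjoint (U i) (U j)) (j : ℕ)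
    (C : Finset (Fin (2 * k + 1) → V)) (hC : ∀ u ∈ C, u ∈ cycleTuples G U)
    (S : Set (Fin (2 * k + 1))) (hS : Fin.ofNat _ (j + 2) ∈ S) :
    projCard C (insert (Fin.ofNat _ (j + 1)) (insert (Fin.ofNat _ j) S)) ≤
      l * Fintype.card V * projCard C S := by
  classical
  have hne : Fin.ofNat (2 * k + 1) (j + 1) ≠ Fin.ofNat _ j := by
    intro h
    have hmod : j ≡ j + 1 [MOD 2 * k + 1] := (congrArg Fin.val h).symm
    have := (Nat.modEq_iff_dvd' (by omega)).mp hmod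
    have := Nat.le_of_dvd (by omega) this
    omega
  have hcard : (C.image fun u => u (Fin.ofNat _ (j + 1))).card +
      (C.image fun u => u (Fin.ofNat _ j)).card ≤ Fintype.card V := by
    rw [← Finset.card_union_of_disjoint]
    · exact Finset.card_le_univ _
    · rw [Finset.disjoint_left]
      intro v hv hv'
      obtain ⟨u, hu, rfl⟩ := Finset.mem_image.mp hv
      obtain ⟨u', hu', h⟩ := Finset.mem_image.mp hv'
      exact Set.disjoint_left.mp (hdisj _ _ hne) ((hC u hu).1 _) (h ▸ (hC u' hu').1 _)
  calc _ ≤ _ := projCard_insert_pair_le hk hl hfree U hdisj j C hC S hS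
    _ ≤ l * (projCard C S * (C.image fun u => u (Fin.ofNat _ (j + 1))).card +
        projCard C S * (C.image fun u => u (Fin.ofNat _ j)).card) := by
      gcongr <;> exact projCard_insert_le _ _ _
    _ = l * ((C.image fun u => u (Fin.ofNat _ (j + 1))).card +
      (C.image fun u => u (Fin.ofNat _ j)).card) * projCard C S := by ring
    _ ≤ _ := by gcongr

/-- Two coordinates at a time are removed below a top segment of coordinates. -/
lemma projCard_union_top_le {V : Type*} [Fintype V] {G : SimpleGraph V} {k l : ℕ}
    (hk : 2 ≤ k) (hl : 2 ≤ l)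
    (hfree : CycleFree G (2 * l) ∨ (CycleFree G (2 * l + 1) ∧ k < l))
    (U : Fin (2 * k + 1) → Set V) (hdisj : ∀ i j, i ≠ j → Disjoint (U i) (U j))
    (C : Finset (Fin (2 * k + 1) → V)) (hC : ∀ u ∈ C, u ∈ cycleTuples G U)
    (b t : ℕ) (ht : t ≤ 2 * k) (ht' : 2 * k ≤ t + 1) (m : ℕ) (hm : 2 * m ≤ t) :
    projCard C {i | i.val ≤ b ∨ t - 2 * m < i.val} ≤
      (l * Fintype.card V) ^ m * projCard C {i | i.val ≤ b ∨ t < i.val} := by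
  induction m with
  | zero => simp
  | succ m ih =>
    have hset : {i : Fin (2 * k + 1) | i.val ≤ b ∨ t - 2 * (m + 1) < i.val} =
        insert (Fin.ofNat _ (t - 2 * m - 1 + 1)) (insert (Fin.ofNat _ (t - 2 * m - 1))
          {i | i.val ≤ b ∨ t - 2 * m < i.val}) := by
      ext i
      simp only [Set.mem_ofPred_eq, Set.mem_insert_iff, Fin.ext_iff, Fin.val_ofNat]
      rw [Nat.mod_eq_of_lt (by omega), Nat.mod_eq_of_lt (by omega)]
      omega
    rw [hset]
    refine (projCard_insert_pair_le_mul hk hl hfree U hdisj _ C hC _ ?_).trans ?_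
    · simp only [Set.mem_ofPred_eq, Fin.val_ofNat]
      rcases lt_or_ge (t - 2 * m - 1 + 2) (2 * k + 1) with h | h
      · rw [Nat.mod_eq_of_lt h]
        omega
      · rw [show t - 2 * m - 1 + 2 = 2 * k + 1 by omega]
        simp
    · rw [pow_succ', mul_assoc (l * _)]
      exact Nat.mul_le_mul_left _ (ih (by omega))

lemma projCard_le_pCount {V : Type*} [Fintype V] {G : SimpleGraph V} {k : ℕ}
    (U : Fin (2 * k + 1) → Set V)
    (C : Finset (Fin (2 * k + 1) → V)) (hC : ∀ u ∈ C, u ∈ cycleTuples G U)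
    (S : Set (Fin (2 * k + 1))) (a b c d : Fin (2 * k + 1)) (hS : S ⊆ {a, b, c, d})
    (hadj : ∀ u ∈ C, G.Adj (u a) (u b) ∧ G.Adj (u b) (u c) ∧ G.Adj (u c) (u d)) :
    projCard C S ≤ pCount G ![U a, U b, U c, U d] := by
  classical
  refine (projCard_le_card_image C S (fun u => ![u a, u b, u c, u d]) ?_).trans ?_
  · intro u _ v _ h
    simp only [Matrix.vecCons_inj, and_true] at h
    intro i hi
    rcases hS hi with rfl | rfl | rfl | rfl
    exacts [h.1, h.2.1, h.2.2.1, h.2.2.2]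
  · rw [pCount, Nat.card_eq_fintype_card, Fintype.card_subtype]
    refine Finset.card_le_card fun p hp => ?_
    obtain ⟨u, hu, rfl⟩ := Finset.mem_image.mp hp
    obtain ⟨h1, h2, h3⟩ := hadj u hu
    refine Finset.mem_filter.mpr ⟨Finset.mem_univ _, ?_, ?_⟩
    · intro i
      fin_cases i <;> exact (hC u hu).1 _
    · intro i hi
      have : i < 3 := by omega
      interval_cases i
      exacts [h1, h2, h3]

theorem stmt16 {V : Type*} [Fintype V] (n k l : ℕ) (hn : Fintype.card V = n)
    (hk : 2 ≤ k) (hl : 2 ≤ l) (G : SimpleGraph V)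
    (hfree : CycleFree G (2 * l) ∨ (CycleFree G (2 * l + 1) ∧ k < l))
    (U : Fin (2 * k + 1) → Set V)
    (hdisj : ∀ i j, i ≠ j → Disjoint (U i) (U j))
    (hcover : (⋃ i, U i) = Set.univ) :
    cCount G U ≤ l ^ (k - 1) * n ^ (k - 2) *
      (pCount G ![U ⟨0, by omega⟩, U ⟨1, by omega⟩, U ⟨2, by omega⟩, U ⟨3, by omega⟩] +
       pCount G ![U ⟨2 * k, by omega⟩, U ⟨0, by omega⟩, U ⟨1, by omega⟩, U ⟨2, by omega⟩]) := by
  classical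
  subst hn
  obtain ⟨q, rfl⟩ : ∃ q, k = q + 2 := ⟨k - 2, by omega⟩
  let C : Finset (Fin (2 * (q + 2) + 1) → V) := Finset.univ.filter (· ∈ cycleTuples G U)
  have hC : ∀ u ∈ C, u ∈ cycleTuples G U := fun u hu => (Finset.mem_filter.mp hu).2
  have hadj : ∀ u ∈ C, ∀ (i : ℕ) (hi : i + 1 < 2 * (q + 2) + 1),
      G.Adj (u ⟨i, by omega⟩) (u ⟨i + 1, hi⟩) := by
    intro u hu i hi
    have h := (hC u hu).2 i
    rwa [show Fin.ofNat (2 * (q + 2) + 1) i = ⟨i, by omega⟩ from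
      Fin.ext (Nat.mod_eq_of_lt (by omega)),
      show Fin.ofNat (2 * (q + 2) + 1) (i + 1) = ⟨i + 1, hi⟩ from
      Fin.ext (Nat.mod_eq_of_lt hi)] at h
  have hclose : ∀ u ∈ C, G.Adj (u ⟨2 * (q + 2), by omega⟩) (u ⟨0, by omega⟩) := by
    intro u hu
    have h := (hC u hu).2 (2 * (q + 2))
    rwa [show Fin.ofNat (2 * (q + 2) + 1) (2 * (q + 2)) = ⟨2 * (q + 2), by omega⟩ from
      Fin.ext (Nat.mod_eq_of_lt (by omega)),
      show Fin.ofNat (2 * (q + 2) + 1) (2 * (q + 2) + 1) = ⟨0, by omega⟩ from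
      Fin.ext (Nat.mod_self _)] at h
  have hcount : cCount G U ≤ projCard C Set.univ := by
    rw [cCount, Nat.card_eq_fintype_card, Fintype.card_subtype, projCard_univ]
    refine Finset.card_le_card fun u hu => ?_
    obtain ⟨-, hmem, huadj⟩ := Finset.mem_filter.mp hu
    refine Finset.mem_filter.mpr ⟨Finset.mem_univ _, hmem, fun t => ?_⟩
    convert huadj (Fin.ofNat _ t) using 2
    apply Fin.ext
    simp [Nat.add_mod]
  have hsplit : projCard C Set.univ ≤ l * (projCard C {i | i.val ≤ 3 ∨ 4 < i.val} +
      projCard C {i | i.val ≤ 2 ∨ 3 < i.val}) := by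
    have h := projCard_insert_pair_le hk hl hfree U hdisj 3 C hC {i | i.val ≤ 2 ∨ 4 < i.val} (by
      simp only [Set.mem_ofPred_eq, Fin.val_ofNat]
      rcases Nat.eq_zero_or_pos q with rfl | hq
      · simp
      · rw [Nat.mod_eq_of_lt (by omega)]
        omega)
    have hval3 : 3 % (2 * (q + 2) + 1) = 3 := Nat.mod_eq_of_lt (by omega)
    have hval4 : (3 + 1) % (2 * (q + 2) + 1) = 4 := Nat.mod_eq_of_lt (by omega)
    have hset3 : insert (Fin.ofNat _ 3) {i : Fin (2 * (q + 2) + 1) | i.val ≤ 2 ∨ 4 < i.val} =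
        {i | i.val ≤ 3 ∨ 4 < i.val} := by
      ext i
      simp only [Set.mem_ofPred_eq, Set.mem_insert_iff, Fin.ext_iff, Fin.val_ofNat, hval3]
      omega
    have hset4 : insert (Fin.ofNat _ (3 + 1))
        {i : Fin (2 * (q + 2) + 1) | i.val ≤ 2 ∨ 4 < i.val} = {i | i.val ≤ 2 ∨ 3 < i.val} := by
      ext i
      simp only [Set.mem_ofPred_eq, Set.mem_insert_iff, Fin.ext_iff, Fin.val_ofNat, hval4]
      omega
    have hset34 : insert (Fin.ofNat _ (3 + 1)) (insert (Fin.ofNat _ 3)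
        {i : Fin (2 * (q + 2) + 1) | i.val ≤ 2 ∨ 4 < i.val}) = Set.univ := by
      ext i
      simp only [Set.mem_ofPred_eq, Set.mem_insert_iff, Set.mem_univ, Fin.ext_iff, Fin.val_ofNat,
        hval3, hval4]
      simp only [iff_true]
      omega
    rwa [hset34, hset3, hset4, add_comm (projCard C _)] at h
  have h1 := projCard_union_top_le hk hl hfree U hdisj C hC 3 (2 * (q + 2)) (by omega) (by omega)
    q (by omega)
  have h2 := projCard_union_top_le hk hl hfree U hdisj C hC 2 (2 * (q + 2) - 1) (by omega)
    (by omega) q (by omega)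
  rw [show 2 * (q + 2) - 2 * q = 4 by omega] at h1
  rw [show 2 * (q + 2) - 1 - 2 * q = 3 by omega] at h2
  have h3 := projCard_le_pCount U C hC {i | i.val ≤ 3 ∨ 2 * (q + 2) < i.val}
    ⟨0, by omega⟩ ⟨1, by omega⟩ ⟨2, by omega⟩ ⟨3, by omega⟩
    (by
      intro i hi
      simp only [Set.mem_ofPred_eq, Set.mem_insert_iff, Set.mem_singleton_iff, Fin.ext_iff] at hi ⊢
      omega)
    fun u hu => ⟨hadj u hu 0 _, hadj u hu 1 _, hadj u hu 2 _⟩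
  have h4 := projCard_le_pCount U C hC {i | i.val ≤ 2 ∨ 2 * (q + 2) - 1 < i.val}
    ⟨2 * (q + 2), by omega⟩ ⟨0, by omega⟩ ⟨1, by omega⟩ ⟨2, by omega⟩
    (by
      intro i hi
      simp only [Set.mem_ofPred_eq, Set.mem_insert_iff, Set.mem_singleton_iff, Fin.ext_iff] at hi ⊢
      omega)
    fun u hu => ⟨hclose u hu, hadj u hu 0 _, hadj u hu 1 _⟩
  calc cCount G U ≤ _ := hcount.trans hsplit
    _ ≤ l * ((l * Fintype.card V) ^ q * _ + (l * Fintype.card V) ^ q * _) :=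
      Nat.mul_le_mul_left _ (add_le_add (h1.trans (Nat.mul_le_mul_left _ h3))
        (h2.trans (Nat.mul_le_mul_left _ h4)))
    _ = _ := by
      rw [show q + 2 - 1 = q + 1 by omega, show q + 2 - 2 = q by omega]
      ring
end
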